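/- In A_inf, inverting [ε]-1 in the p-complete sense agrees with inverting d = ([ε]-1)/([ε^{1/p}]-1) in the p-complete sense: the p-completions of A_inf[1/([ε]-1)] and A_inf[1/d] are canonically isomorphic. -/

import Mathlib

/-- An element that is a unit modulo `I` is a unit modulo every power of `I`. -/
theorem Ideal.Quotient.isUnit_mk_pow {R : Type*} [CommRing R] {I : Ideal R} {x : R}
    (hx : IsUnit (Ideal.Quotient.mk I x)) (n : ℕ) : IsUnit (Ideal.Quotient.mk (I ^ n) x) := by
  obtain ⟨y, hy⟩ := hx.exists_right_inv
  obtain ⟨y, rfl⟩ := Ideal.Quotient.mk_surjective y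
  have hmem : 1 - x * y ∈ I := by
    rw [← Ideal.Quotient.eq, map_one, map_mul, hy]
  have hdvd : x ∣ 1 - (1 - x * y) ^ n := by
    have h := sub_dvd_pow_sub_pow (1 : R) (1 - x * y) n
    rw [one_pow, sub_sub_cancel] at h
    exact (dvd_mul_right x y).trans h
  obtain ⟨z, hz⟩ := hdvd
  refine IsUnit.of_mul_eq_one (Ideal.Quotient.mk _ z) ?_
  rw [← map_mul, ← hz, map_sub, map_one,
    Ideal.Quotient.eq_zero_iff_mem.mpr (Ideal.pow_mem_pow hmem n), sub_zero]

section Localization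

variable {A R S T : Type*} [CommRing A] [CommRing R] [CommRing S] [CommRing T]
  [Algebra A R] [Algebra A S] [Algebra A T]

/-- Algebra maps out of a quotient of a localization are unique. -/
theorem IsLocalization.quotient_algHom_ext (M : Submonoid A) [IsLocalization M R]
    (I : Ideal R) (f g : (R ⧸ I) →ₐ[A] T) : f = g :=
  Ideal.Quotient.algHom_ext A (IsLocalization.algHom_ext M (Subsingleton.elim _ _))

/-- If `d` is invertible in `S` modulo `q`, then `A[1/d] / q` maps to `S / q`. -/
noncomputable def IsLocalization.Away.quotientSpanPowLift (d : A) [IsLocalization.Away d R]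
    (q : ℕ) (hd : IsUnit (Ideal.Quotient.mk (Ideal.span {(q : S)}) (algebraMap A S d))) (n : ℕ) :
    (R ⧸ Ideal.span {(q : R)} ^ n) →ₐ[A] (S ⧸ Ideal.span {(q : S)} ^ n) :=
  Ideal.Quotient.liftₐ _
    (IsLocalization.liftAlgHom (M := Submonoid.powers d)
      (f := Algebra.ofId A (S ⧸ Ideal.span {(q : S)} ^ n)) (by
        rintro ⟨_, k, rfl⟩
        rw [map_pow]
        exact (Ideal.Quotient.isUnit_mk_pow hd n).pow k))
    (by
      intro a ha
      rw [Ideal.span_singleton_pow, Ideal.mem_span_singleton] at ha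
      obtain ⟨c, rfl⟩ := ha
      rw [map_mul, map_pow, map_natCast]
      convert zero_mul _
      rw [← map_natCast (Ideal.Quotient.mk _), ← map_pow, Ideal.Quotient.eq_zero_iff_mem]
      exact Ideal.pow_mem_pow (Ideal.mem_span_singleton_self _) n)

/-- The evaluation maps of an adic completion are compatible with the transition maps. -/
theorem AdicCompletion.factorPow_evalₐ (I : Ideal R) {m n : ℕ} (h : m ≤ n)
    (x : AdicCompletion I R) :
    Ideal.Quotient.factorPow I h (evalₐ I n x) = evalₐ I m x := by
  induction x using AdicCompletion.induction_on with
  | _ x => simpa using Ideal.mk_eq_mk I h x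

/-- A compatible family of isomorphisms of quotients induces an isomorphism of adic completions. -/
noncomputable def AdicCompletion.ringEquivOfQuotients {I : Ideal R} {J : Ideal S}
    (e : ∀ n, (R ⧸ I ^ n) ≃+* (S ⧸ J ^ n))
    (he : ∀ {m n : ℕ} (h : m ≤ n) (x : R ⧸ I ^ n),
      Ideal.Quotient.factorPow J h (e n x) = e m (Ideal.Quotient.factorPow I h x)) :
    AdicCompletion I R ≃+* AdicCompletion J S :=
  have hf {m n : ℕ} (h : m ≤ n) : (Ideal.Quotient.factorPow J h).comp
      ((e n : _ →+* _).comp (evalₐ I n : AdicCompletion I R →+* R ⧸ I ^ n)) =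
      (e m : _ →+* _).comp (evalₐ I m : AdicCompletion I R →+* R ⧸ I ^ m) :=
    RingHom.ext fun x ↦ (he h _).trans (congrArg (e m) (factorPow_evalₐ I h x))
  have hg {m n : ℕ} (h : m ≤ n) : (Ideal.Quotient.factorPow I h).comp
      (((e n).symm : _ →+* _).comp (evalₐ J n : AdicCompletion J S →+* S ⧸ J ^ n)) =
      ((e m).symm : _ →+* _).comp (evalₐ J m : AdicCompletion J S →+* S ⧸ J ^ m) :=
    RingHom.ext fun x ↦ (e m).injective <| by
      simp only [RingHom.comp_apply, RingHom.coe_coe, ← he, RingEquiv.apply_symm_apply]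
      exact factorPow_evalₐ J h x
  RingEquiv.ofRingHom (liftRingHom J _ hf) (liftRingHom I _ hg)
    (RingHom.ext fun x ↦ ext_evalₐ fun n ↦ by simp)
    (RingHom.ext fun x ↦ ext_evalₐ fun n ↦ by simp)

/-- If each of `b` and `d` is invertible modulo `q` after inverting the other, then the `q`-adic
completions of `A[1/b]` and `A[1/d]` are isomorphic. -/
noncomputable def IsLocalization.Away.adicCompletionEquiv (b d : A) [IsLocalization.Away b R]
    [IsLocalization.Away d S] (q : ℕ)
    (hb : IsUnit (Ideal.Quotient.mk (Ideal.span {(q : S)}) (algebraMap A S b)))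
    (hd : IsUnit (Ideal.Quotient.mk (Ideal.span {(q : R)}) (algebraMap A R d))) :
    AdicCompletion (Ideal.span {(q : R)}) R ≃+* AdicCompletion (Ideal.span {(q : S)}) S :=
  AdicCompletion.ringEquivOfQuotients
    (fun n ↦ (AlgEquiv.ofAlgHom (quotientSpanPowLift b q hb n) (quotientSpanPowLift d q hd n)
      (quotient_algHom_ext (Submonoid.powers d) _ _ _)
      (quotient_algHom_ext (Submonoid.powers b) _ _ _)).toRingEquiv)
    (fun {m n} h x ↦ DFunLike.congr_fun (quotient_algHom_ext (Submonoid.powers b) _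
      ((Ideal.Quotient.factorₐ A (Ideal.pow_le_pow_right h)).comp (quotientSpanPowLift b q hb n))
      ((quotientSpanPowLift b q hb m).comp
        (Ideal.Quotient.factorₐ A (Ideal.pow_le_pow_right h)))) x)

end Localization


/-- Abstract form of: in `A_inf`, inverting `[ε]-1` in the `p`-complete sense
agrees with inverting `d = ([ε]-1)/([ε^{1/p}]-1)`: given `b = d·u` with
`b ≡ u^p (mod p)` and `d ≡ u^{p-1} (mod p)`, the `p`-adic completions of
`A[1/b]` and `A[1/d]` are isomorphic. -/
theorem stmt9 (p : ℕ) [Fact p.Prime] (A : Type*) [CommRing A]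
    (b d u : A)
    (hbu : b = d * u)
    (hb : b - u ^ p ∈ Ideal.span {(p : A)})
    (hd : d - u ^ (p - 1) ∈ Ideal.span {(p : A)}) :
    Nonempty
      (AdicCompletion (Ideal.span {(p : Localization.Away b)}) (Localization.Away b) ≃+*
       AdicCompletion (Ideal.span {(p : Localization.Away d)}) (Localization.Away d)) := by
  have hp : p - 1 ≠ 0 := Nat.sub_ne_zero_of_lt (Fact.out : p.Prime).one_lt
  refine ⟨IsLocalization.Away.adicCompletionEquiv b d p ?_ ?_⟩
  · have hdu : IsUnit (algebraMap A (Localization.Away d) d) :=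
      IsLocalization.Away.algebraMap_isUnit d
    have hmk : Ideal.Quotient.mk (Ideal.span {(p : Localization.Away d)})
        (algebraMap A _ d) = Ideal.Quotient.mk _ (algebraMap A _ u) ^ (p - 1) := by
      rw [← map_pow, ← map_pow, Ideal.Quotient.eq, ← map_sub]
      simpa [Ideal.map_span] using Ideal.mem_map_of_mem (algebraMap A (Localization.Away d)) hd
    have huu := hdu.map (Ideal.Quotient.mk (Ideal.span {(p : Localization.Away d)}))
    rw [hmk, isUnit_pow_iff hp] at huu
    rw [hbu, map_mul, map_mul]
    exact (hdu.map _).mul huu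
  · have hbu' : IsUnit (algebraMap A (Localization.Away b) b) :=
      IsLocalization.Away.algebraMap_isUnit b
    refine IsUnit.map _ (isUnit_of_dvd_unit ?_ hbu')
    exact map_dvd _ ⟨u, hbu⟩
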